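/- arXiv:2404.11175 — 2 statements merged into one kernel-verified Lean document; each statement's English description precedes it below -/
import Mathlib

section
/- (Tensor-product case, lower-bound part, Eq. (previous_result).) Let dA dB : ℕ with dA ≥ 1 and dB ≥ 1, let ι := Fin dA × Fin dB, and let ρ : Matrix ι ι ℂ be Hermitian, positive semidefinite, with trace 1. Let p : Fin (dA · dB) → ℝ be the eigenvalues of ρ listed in decreasing order and set q j := Σ_{a : Fin dA} p (j · dA + a) for j : Fin dB. Then for every unitary matrix U in the unitary group of Matrix ι ι ℂ, S(Tr_A (U ρ U*)) ≥ Σ_{j : Fin dB} (− q j · Real.log (q j)). -/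
open scoped Classical Matrix ComplexOrder

namespace AQD

/-- Von Neumann entropy of a (Hermitian) matrix: `∑ i, -λ_i log λ_i` where `λ` are the
eigenvalues; defined to be `0` on non-Hermitian matrices. -/
noncomputable def vnEntropy {n : Type*} [Fintype n] [DecidableEq n] (M : Matrix n n ℂ) : ℝ :=
  if hM : M.IsHermitian then ∑ i, (- hM.eigenvalues i * Real.log (hM.eigenvalues i)) else 0

/-- The index `j * dA + a` as an element of `Fin (dA * dB)`. -/
def idx2 (dA dB : ℕ) (b : Fin dB) (a : Fin dA) : Fin (dA * dB) :=
  ⟨(b : ℕ) * dA + (a : ℕ), by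
    have ha := a.isLt
    have hb := b.isLt
    calc (b : ℕ) * dA + (a : ℕ) < ((b : ℕ) + 1) * dA := by rw [Nat.add_mul, Nat.one_mul]; omega
      _ ≤ dB * dA := Nat.mul_le_mul_right _ hb
      _ = dA * dB := Nat.mul_comm _ _⟩

/-- Partial trace over subsystem `A` for the tensor-product index `Fin dA × Fin dB`. -/
noncomputable def ptraceProd (dA dB : ℕ)
    (M : Matrix (Fin dA × Fin dB) (Fin dA × Fin dB) ℂ) : Matrix (Fin dB) (Fin dB) ℂ :=
  fun b b' => ∑ a : Fin dA, M (a, b) (a, b')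

/-- The entrywise squared modulus of a unitary matrix is doubly stochastic. -/
lemma normSq_mem_doublyStochastic {n : Type*} [Fintype n] [DecidableEq n]
    (W : Matrix.unitaryGroup n ℂ) :
    (Matrix.of fun i j => Complex.normSq ((W : Matrix n n ℂ) i j)) ∈ doublyStochastic ℝ n := by
  rw [mem_doublyStochastic_iff_sum]
  refine ⟨fun i j => Complex.normSq_nonneg _, fun i => ?_, fun j => ?_⟩
  · have h := congrFun (congrFun (Matrix.mem_unitaryGroup_iff.mp W.2) i) i
    simp only [Matrix.mul_apply, Matrix.star_apply, Matrix.one_apply_eq, RCLike.star_def,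
      Complex.mul_conj] at h
    exact_mod_cast h
  · have h := congrFun (congrFun (Matrix.mem_unitaryGroup_iff'.mp W.2) j) j
    simp only [Matrix.mul_apply, Matrix.star_apply, Matrix.one_apply_eq, RCLike.star_def,
      ← Complex.normSq_eq_conj_mul_self] at h
    exact_mod_cast h

/-- Rearrangement inequality for doubly stochastic matrices. -/
lemma sum_mul_doublyStochastic_mul_le {n : Type*} [Fintype n] [DecidableEq n]
    {D : Matrix n n ℝ} (hD : D ∈ doublyStochastic ℝ n) {f g : n → ℝ} (hfg : Monovary f g) :
    ∑ i, ∑ j, f i * (D i j * g j) ≤ ∑ i, f i * g i := by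
  obtain ⟨w, hw, hw1, rfl⟩ := exists_eq_sum_perm_of_mem_doublyStochastic hD
  calc ∑ i, ∑ j, f i * ((∑ σ, w σ • σ.permMatrix ℝ) i j * g j)
      = ∑ σ, w σ * ∑ i, f i * g (σ i) := by
        simp only [Matrix.sum_apply, Matrix.smul_apply, smul_eq_mul, Finset.sum_mul,
          Finset.mul_sum]
        rw [Finset.sum_congr rfl fun i _ => Finset.sum_comm, Finset.sum_comm]
        refine Finset.sum_congr rfl fun σ _ => Finset.sum_congr rfl fun i _ => ?_
        rw [Finset.sum_eq_single (σ i)]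
        · simp [PEquiv.toMatrix_apply]
          ring
        · intro j _ hj
          simp [PEquiv.toMatrix_apply, hj.symm]
        · simp
    _ ≤ ∑ σ, w σ * ∑ i, f i * g i :=
        Finset.sum_le_sum fun σ _ =>
          mul_le_mul_of_nonneg_left hfg.sum_mul_comp_perm_le_sum_mul (hw σ)
    _ = ∑ i, f i * g i := by rw [← Finset.sum_mul, hw1, one_mul]

/-- Gibbs-type tangent-line bound for `-x log x`. -/
lemma neg_mul_log_le {x t : ℝ} (hx : 0 ≤ x) (ht : 0 < t) :
    -x * Real.log x ≤ -x * Real.log t + t - x := by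
  rcases hx.eq_or_lt with rfl | hx
  · simp [ht.le]
  · have h := mul_le_mul_of_nonneg_left (Real.log_le_sub_one_of_pos (div_pos ht hx)) hx.le
    rw [Real.log_div ht.ne' hx.ne', mul_sub, mul_sub, mul_div_cancel₀ _ hx.ne'] at h
    linarith

/-- Schur concavity of entropy, with majorization tested against antitone weights. -/
lemma entropy_le_of_sum_mul_le {m : ℕ} {r q : Fin m → ℝ} (hr : ∀ j, 0 ≤ r j)
    (hq : ∀ j, 0 ≤ q j) (hanti : Antitone r)
    (h : ∀ c : Fin m → ℝ, Antitone c → ∑ j, c j * r j ≤ ∑ j, c j * q j) :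
    ∑ j, -q j * Real.log (q j) ≤ ∑ j, -r j * Real.log (r j) := by
  have key : ∀ ε : ℝ, 0 < ε →
      ∑ j, -q j * Real.log (q j) ≤ ∑ j, -r j * Real.log (r j) + m * ε := by
    intro ε hε
    have hpos : ∀ j, 0 < r j + ε := fun j => add_pos_of_nonneg_of_pos (hr j) hε
    have h1 := h (fun _ => 1) antitone_const
    have h2 := h (fun j => Real.log (r j + ε)) fun i j hij =>
      Real.log_le_log (hpos j) (by linarith [hanti hij])
    have h3 := Finset.sum_le_sum fun j (_ : j ∈ Finset.univ) => neg_mul_log_le (hq j) (hpos j)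
    have h4 : ∑ j, r j * Real.log (r j) ≤ ∑ j, Real.log (r j + ε) * r j := by
      refine Finset.sum_le_sum fun j _ => ?_
      rcases (hr j).eq_or_lt with h0 | h0
      · simp [← h0]
      · rw [mul_comm]
        exact mul_le_mul_of_nonneg_right (Real.log_le_log h0 (by linarith)) h0.le
    have h5 : ∑ j, (-q j * Real.log (r j + ε) + (r j + ε) - q j) =
        -(∑ j, Real.log (r j + ε) * q j) + ∑ j, r j + m * ε - ∑ j, q j := by
      simp [Finset.sum_add_distrib, Finset.sum_sub_distrib, mul_comm, add_assoc]
    simp only [one_mul] at h1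
    simp only [neg_mul, Finset.sum_neg_distrib] at h3 h5 ⊢
    linarith
  have hlim : Filter.Tendsto (fun ε : ℝ => ∑ j, -r j * Real.log (r j) + m * ε)
      (nhdsWithin 0 (Set.Ioi 0)) (nhds (∑ j, -r j * Real.log (r j))) := by
    have hc : Continuous fun ε : ℝ => ∑ j, -r j * Real.log (r j) + m * ε := by fun_prop
    simpa using (hc.tendsto 0).mono_left nhdsWithin_le_nhds
  exact ge_of_tendsto hlim (Filter.eventually_of_mem self_mem_nhdsWithin key)

lemma idx2_bijective (dA dB : ℕ) :
    Function.Bijective fun x : Fin dA × Fin dB => idx2 dA dB x.2 x.1 := by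
  rw [Fintype.bijective_iff_injective_and_card]
  refine ⟨?_, by simp⟩
  rintro ⟨a, b⟩ ⟨a', b'⟩ h
  have h' : (b : ℕ) * dA + a = b' * dA + a' := congrArg Fin.val h
  have hA : 0 < dA := a.pos
  have hb : (b : ℕ) = b' := by
    have h2 := congrArg (· / dA) h'
    simpa [Nat.mul_add_div, mul_comm _ dA, hA, Nat.div_eq_of_lt a.isLt,
      Nat.div_eq_of_lt a'.isLt] using h2
  have ha : (a : ℕ) = a' := by
    rw [hb] at h'
    omega
  exact Prod.ext (Fin.ext ha) (Fin.ext hb)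

lemma idx2_le_of_snd_lt {dA dB : ℕ} {b b' : Fin dB} (a a' : Fin dA) (h : b < b') :
    idx2 dA dB b a ≤ idx2 dA dB b' a' := by
  have h1 : ((b : ℕ) + 1) * dA ≤ b' * dA := Nat.mul_le_mul_right _ h
  have ha := a.isLt
  change (b : ℕ) * dA + a ≤ b' * dA + a'
  rw [add_mul, one_mul] at h1
  omega

lemma isHermitian_ptraceProd {dA dB : ℕ}
    {M : Matrix (Fin dA × Fin dB) (Fin dA × Fin dB) ℂ} (hM : M.IsHermitian) :
    (ptraceProd dA dB M).IsHermitian := by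
  ext b b'
  simp [ptraceProd, Matrix.conjTranspose_apply, hM.apply]

/-- Conjugation by `1 ⊗ V` commutes with the partial trace. -/
lemma ptraceProd_conj_kronecker (dA dB : ℕ)
    (M : Matrix (Fin dA × Fin dB) (Fin dA × Fin dB) ℂ) (V : Matrix (Fin dB) (Fin dB) ℂ) :
    ptraceProd dA dB ((Matrix.kronecker (1 : Matrix (Fin dA) (Fin dA) ℂ) V)ᴴ * M *
      Matrix.kronecker (1 : Matrix (Fin dA) (Fin dA) ℂ) V) = Vᴴ * ptraceProd dA dB M * V := by
  ext b b'
  simp only [ptraceProd, Matrix.mul_apply, Matrix.conjTranspose_apply, Matrix.kronecker,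
    Matrix.kroneckerMap_apply, Fintype.sum_prod_type, Matrix.one_apply, Finset.sum_mul,
    Finset.mul_sum, ite_mul, mul_ite, one_mul, zero_mul, mul_zero, apply_ite star, star_zero,
    Finset.sum_ite_irrel, Finset.sum_const_zero, Finset.sum_ite_eq',
    Finset.mem_univ, if_true]
  rw [Finset.sum_comm]
  refine Finset.sum_congr rfl fun x _ => ?_
  rw [Finset.sum_comm]

lemma mul_diagonal_mul_conjTranspose_apply_self {n : Type*} [Fintype n] [DecidableEq n]
    (W : Matrix n n ℂ) (d : n → ℝ) (x : n) :
    (W * Matrix.diagonal (fun i => (d i : ℂ)) * Wᴴ) x x =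
      ((∑ i, Complex.normSq (W x i) * d i : ℝ) : ℂ) := by
  rw [Matrix.mul_apply]
  push_cast
  refine Finset.sum_congr rfl fun i _ => ?_
  rw [Matrix.mul_diagonal, Matrix.conjTranspose_apply, RCLike.star_def, mul_right_comm,
    Complex.mul_conj]

/-- The eigenvalues of a partial trace of `U ρ U*` are block sums of a unistochastic image of the
eigenvalues of `ρ`. -/
lemma exists_unitary_eigenvalues_ptraceProd (dA dB : ℕ)
    (ρ : Matrix (Fin dA × Fin dB) (Fin dA × Fin dB) ℂ) (hρ : ρ.IsHermitian)
    (U : Matrix.unitaryGroup (Fin dA × Fin dB) ℂ)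
    (hτ : (ptraceProd dA dB ((U : Matrix _ _ ℂ) * ρ * (U : Matrix _ _ ℂ)ᴴ)).IsHermitian) :
    ∃ W : Matrix.unitaryGroup (Fin dA × Fin dB) ℂ, ∀ j, hτ.eigenvalues j =
      ∑ a, ∑ i, Complex.normSq (W.1 (a, j) i) * hρ.eigenvalues i := by
  obtain ⟨V, hV⟩ : ∃ V : Matrix.unitaryGroup (Fin dB) ℂ, (V : Matrix _ _ ℂ)ᴴ *
      ptraceProd dA dB ((U : Matrix _ _ ℂ) * ρ * (U : Matrix _ _ ℂ)ᴴ) * (V : Matrix _ _ ℂ) =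
      Matrix.diagonal (fun i => (hτ.eigenvalues i : ℂ)) := by
    refine ⟨hτ.eigenvectorUnitary, ?_⟩
    have h := hτ.conjStarAlgAut_star_eigenvectorUnitary
    rw [Unitary.conjStarAlgAut_apply] at h
    simpa [Matrix.star_eq_conjTranspose, Function.comp_def] using h
  obtain ⟨K, hK⟩ : ∃ K : Matrix.unitaryGroup (Fin dA × Fin dB) ℂ,
      (K : Matrix _ _ ℂ) = Matrix.kronecker (1 : Matrix (Fin dA) (Fin dA) ℂ) V.1 :=
    ⟨⟨_, Matrix.kronecker_mem_unitary (one_mem _) V.2⟩, rfl⟩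
  refine ⟨star K * U * hρ.eigenvectorUnitary, fun j => ?_⟩
  have hE : ρ = (hρ.eigenvectorUnitary : Matrix _ _ ℂ) *
      Matrix.diagonal (fun i => (hρ.eigenvalues i : ℂ)) *
      (hρ.eigenvectorUnitary : Matrix _ _ ℂ)ᴴ := by
    have h := hρ.spectral_theorem
    rw [Unitary.conjStarAlgAut_apply] at h
    simpa [Matrix.star_eq_conjTranspose, Function.comp_def] using h
  have h := congrFun (congrFun hV j) j
  rw [← ptraceProd_conj_kronecker, Matrix.diagonal_apply_eq] at h
  have hconj : (K : Matrix _ _ ℂ)ᴴ * ((U : Matrix _ _ ℂ) * ρ * (U : Matrix _ _ ℂ)ᴴ) *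
      (K : Matrix _ _ ℂ) =
      ((star K * U * hρ.eigenvectorUnitary : Matrix.unitaryGroup _ ℂ) : Matrix _ _ ℂ) *
      Matrix.diagonal (fun i => (hρ.eigenvalues i : ℂ)) *
      ((star K * U * hρ.eigenvectorUnitary : Matrix.unitaryGroup _ ℂ) : Matrix _ _ ℂ)ᴴ := by
    conv_lhs => rw [hE]
    simp only [Submonoid.coe_mul, Unitary.coe_star, Matrix.star_eq_conjTranspose,
      Matrix.conjTranspose_mul, Matrix.conjTranspose_conjTranspose, Matrix.mul_assoc]
  rw [← hK, hconj] at h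
  simp only [ptraceProd, mul_diagonal_mul_conjTranspose_apply_self] at h
  exact_mod_cast h.symm

/-- **Tensor-product case, lower-bound part.** For `ρ` Hermitian, positive semidefinite with
trace `1` on `Fin dA × Fin dB`, eigenvalues `p` listed in decreasing order and
`q j = ∑_a p (j * dA + a)`, every unitary `U` satisfies
`S(Tr_A (U ρ U*)) ≥ ∑_j (- q j * log (q j))`. -/
theorem tensor_entropy_lower_bound (dA dB : ℕ) (hA : 1 ≤ dA) (hB : 1 ≤ dB)
    (ρ : Matrix (Fin dA × Fin dB) (Fin dA × Fin dB) ℂ)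
    (hρ : ρ.IsHermitian) (hpos : ρ.PosSemidef) (htr : Matrix.trace ρ = 1)
    (p : Fin (dA * dB) → ℝ) (hp : Antitone p)
    (e : Fin (dA * dB) ≃ (Fin dA × Fin dB)) (hpe : ∀ i, p i = hρ.eigenvalues (e i))
    (U : Matrix.unitaryGroup (Fin dA × Fin dB) ℂ) :
    vnEntropy (ptraceProd dA dB ((U : Matrix _ _ ℂ) * ρ * (U : Matrix _ _ ℂ)ᴴ)) ≥
      ∑ j : Fin dB, (- (∑ a : Fin dA, p (idx2 dA dB j a)) *
        Real.log (∑ a : Fin dA, p (idx2 dA dB j a))) := by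
  have hτ := isHermitian_ptraceProd
    (Matrix.isHermitian_mul_mul_conjTranspose U.1 hρ)
  obtain ⟨W, hW⟩ := exists_unitary_eigenvalues_ptraceProd dA dB ρ hρ U hτ
  have hp0 : ∀ i, 0 ≤ p i := fun i => hpe i ▸ hpos.eigenvalues_nonneg _
  rw [vnEntropy, dif_pos hτ, ge_iff_le]
  let s : Equiv.Perm (Fin dB) := Tuple.sort (fun j => -hτ.eigenvalues j)
  have hs : Antitone fun j => hτ.eigenvalues (s j) := fun i j hij =>
    neg_le_neg_iff.mp (Tuple.monotone_sort (fun j => -hτ.eigenvalues j) hij)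
  rw [← Equiv.sum_comp s fun j => -hτ.eigenvalues j * Real.log (hτ.eigenvalues j)]
  refine entropy_le_of_sum_mul_le (r := fun j => hτ.eigenvalues (s j))
    (q := fun j => ∑ a, p (idx2 dA dB j a)) (fun j => ?_)
    (fun j => Finset.sum_nonneg fun a _ => hp0 _) hs fun c hc => ?_
  · rw [hW]
    exact Finset.sum_nonneg fun a _ => Finset.sum_nonneg fun i _ =>
      mul_nonneg (Complex.normSq_nonneg _) (hpos.eigenvalues_nonneg i)
  let E : (Fin dA × Fin dB) ≃ Fin (dA * dB) := Equiv.ofBijective _ (idx2_bijective dA dB)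
  let rows : (Fin dA × Fin dB) ≃ (Fin dA × Fin dB) := Equiv.prodCongr (Equiv.refl _) s
  have hD := reindex_mem_doublyStochastic (e₁ := rows.symm) (e₂ := (E.trans e).symm)
    (normSq_mem_doublyStochastic W)
  have hmono : Monovary (fun x : Fin dA × Fin dB => c x.2) (fun x => p (E x)) := by
    intro x y hxy
    refine hc (le_of_not_gt fun hlt => hxy.not_ge (hp ?_))
    exact idx2_le_of_snd_lt x.1 y.1 hlt
  have hle := sum_mul_doublyStochastic_mul_le hD hmono
  calc ∑ j, c j * hτ.eigenvalues (s j)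
      = ∑ x : Fin dA × Fin dB, ∑ y : Fin dA × Fin dB,
          c x.2 * (Complex.normSq (W.1 (x.1, s x.2) (e (E y))) * p (E y)) := by
        rw [Fintype.sum_prod_type_right]
        refine Finset.sum_congr rfl fun j _ => ?_
        rw [hW, Finset.mul_sum]
        refine Finset.sum_congr rfl fun a _ => ?_
        rw [← Equiv.sum_comp (E.trans e), Finset.mul_sum]
        simp [hpe]
    _ ≤ ∑ x : Fin dA × Fin dB, c x.2 * p (E x) := hle
    _ = ∑ j, c j * ∑ a, p (idx2 dA dB j a) := by
        simp only [Fintype.sum_prod_type_right, Finset.mul_sum]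
        rfl

end AQD
end

section
/- (Particle-number corollary to Theorem 1.) Let w : Fin K → ℕ assign to each sector k the boson number of the B-block (so the particle-number operator of B is the diagonal matrix N̂_B on ιB taking the value w k on the block Fin (dB k)). Then there exists a unitary matrix U in the unitary group of Matrix ι ι ℂ that simultaneously attains the minimal entropy, S(Tr_A (U ρ U*)) = Σ_{k,b} (− q k b · Real.log (q k b)), and has particle-number expectation Matrix.trace (N̂_B * Tr_A (U ρ U*)) = Σ_{k : Fin K} (w k : ℝ) · Σ_{b : Fin (dB k)} q k b. -/
open scoped Classical Matrix ComplexOrder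

namespace AQD

variable {K : ℕ}

/-- `offset k = ∑_{k' < k} dA k' * dB k'`. -/
def offset (dA dB : Fin K → ℕ) (k : Fin K) : ℕ :=
  ∑ k' ∈ Finset.Iio k, dA k' * dB k'

theorem idx_lt (dA dB : Fin K → ℕ) (k : Fin K) (b : Fin (dB k)) (a : Fin (dA k)) :
    offset dA dB k + (b : ℕ) * dA k + (a : ℕ) < ∑ k', dA k' * dB k' := by
  have ha := a.isLt
  have hb := b.isLt
  have h1 : (b : ℕ) * dA k + (a : ℕ) < dA k * dB k := by
    have h2 : ((b : ℕ) + 1) * dA k ≤ dB k * dA k := Nat.mul_le_mul_right _ hb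
    have h3 : (b : ℕ) * dA k + (a : ℕ) < ((b : ℕ) + 1) * dA k := by
      rw [Nat.add_mul, Nat.one_mul]; omega
    calc (b : ℕ) * dA k + (a : ℕ) < ((b : ℕ) + 1) * dA k := h3
      _ ≤ dB k * dA k := h2
      _ = dA k * dB k := Nat.mul_comm _ _
  have hsub : Finset.Iio k ⊆ (Finset.univ : Finset (Fin K)) := Finset.subset_univ _
  have hsplit : ∑ k' ∈ (Finset.univ : Finset (Fin K)) \ Finset.Iio k, dA k' * dB k' +
      ∑ k' ∈ Finset.Iio k, dA k' * dB k' = ∑ k', dA k' * dB k' :=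
    Finset.sum_sdiff hsub
  have hk : k ∈ (Finset.univ : Finset (Fin K)) \ Finset.Iio k := by simp
  have hle : dA k * dB k ≤ ∑ k' ∈ (Finset.univ : Finset (Fin K)) \ Finset.Iio k, dA k' * dB k' :=
    Finset.single_le_sum (f := fun k' => dA k' * dB k') (fun i _ => Nat.zero_le _) hk
  unfold offset
  omega

/-- The index `offset k + b * dA k + a` as an element of `Fin (∑_k dA k * dB k)`. -/
def idx (dA dB : Fin K → ℕ) (k : Fin K) (b : Fin (dB k)) (a : Fin (dA k)) :
    Fin (∑ k', dA k' * dB k') :=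
  ⟨offset dA dB k + (b : ℕ) * dA k + (a : ℕ), idx_lt dA dB k b a⟩

/-- Partial trace over subsystem `A`. -/
noncomputable def ptraceA (dA dB : Fin K → ℕ)
    (M : Matrix (Σ k : Fin K, Fin (dA k) × Fin (dB k)) (Σ k : Fin K, Fin (dA k) × Fin (dB k)) ℂ) :
    Matrix (Σ k : Fin K, Fin (dB k)) (Σ k : Fin K, Fin (dB k)) ℂ :=
  fun x y =>
    if h : y.1 = x.1 then ∑ a : Fin (dA x.1), M ⟨x.1, (a, x.2)⟩ ⟨x.1, (a, h ▸ y.2)⟩ else 0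

/-- `q k b = ∑_a p (offset k + b * dA k + a)`. -/
noncomputable def qval (dA dB : Fin K → ℕ) (p : Fin (∑ k', dA k' * dB k') → ℝ)
    (k : Fin K) (b : Fin (dB k)) : ℝ :=
  ∑ a : Fin (dA k), p (idx dA dB k b a)

theorem isHermitian_diagonal_ofReal {n : Type*} [DecidableEq n] (d : n → ℝ) :
    (Matrix.diagonal (fun i => (d i : ℂ))).IsHermitian :=
  Matrix.isHermitian_diagonal_iff.mpr fun i => Complex.conj_ofReal (d i)

/-- The entropy of a real diagonal matrix is the Shannon entropy of its diagonal. -/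
theorem vnEntropy_diagonal {n : Type*} [Fintype n] [DecidableEq n] (d : n → ℝ) :
    vnEntropy (Matrix.diagonal (fun i => (d i : ℂ))) = ∑ i, (- d i * Real.log (d i)) := by
  have hM := isHermitian_diagonal_ofReal d
  have hroots := hM.roots_charpoly_eq_eigenvalues
  have hprod : (Matrix.diagonal (fun i => (d i : ℂ))).charpoly.roots =
      Finset.univ.val.map (fun i => (d i : ℂ)) := by
    rw [Matrix.charpoly_diagonal]
    have h := Polynomial.roots_multiset_prod_X_sub_C (Finset.univ.val.map fun i => (d i : ℂ))
    rwa [Multiset.map_map] at h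
  rw [hprod] at hroots
  have hsum := congrArg
    (fun s : Multiset ℂ => (s.map fun z => - z.re * Real.log z.re).sum) hroots
  simp only [Multiset.map_map, Function.comp_def] at hsum
  rw [vnEntropy, dif_pos hM]
  exact hsum.symm

/-- A Hermitian matrix is unitarily conjugate to the diagonal matrix of its eigenvalues, listed
in any prescribed order. -/
theorem exists_unitary_conj_eq_diagonal {n : Type*} [Fintype n] [DecidableEq n]
    {A : Matrix n n ℂ} (hA : A.IsHermitian) (σ : n ≃ n) :
    ∃ U : Matrix.unitaryGroup n ℂ, (U : Matrix n n ℂ) * A * (U : Matrix n n ℂ)ᴴ =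
      Matrix.diagonal (fun i => (hA.eigenvalues (σ i) : ℂ)) := by
  let V : Matrix n n ℂ := hA.eigenvectorUnitary
  have hV : Vᴴ * V = 1 := Unitary.coe_star_mul_self hA.eigenvectorUnitary
  have hdiag : Vᴴ * A * V = Matrix.diagonal (fun i => (hA.eigenvalues i : ℂ)) := by
    have h := hA.conjStarAlgAut_star_eigenvectorUnitary
    rwa [Unitary.conjStarAlgAut_star_apply] at h
  have hU : Vᴴ.submatrix σ id ∈ Matrix.unitaryGroup n ℂ := by
    rw [Matrix.mem_unitaryGroup_iff, Matrix.star_eq_conjTranspose, Matrix.conjTranspose_submatrix,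
      Matrix.conjTranspose_conjTranspose,
      ← Matrix.submatrix_mul _ _ _ _ _ Function.bijective_id, hV, Matrix.submatrix_one_equiv]
  refine ⟨⟨_, hU⟩, ?_⟩
  have hmul : Vᴴ.submatrix σ id * A = (Vᴴ * A).submatrix σ id := by
    rw [Matrix.submatrix_mul _ _ _ id _ Function.bijective_id, Matrix.submatrix_id_id]
  change Vᴴ.submatrix σ id * A * (Vᴴ.submatrix σ id)ᴴ = _
  rw [hmul, Matrix.conjTranspose_submatrix, Matrix.conjTranspose_conjTranspose,
    ← Matrix.submatrix_mul _ _ _ _ _ Function.bijective_id, hdiag,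
    Matrix.submatrix_diagonal_equiv]
  rfl

theorem offset_add_le_offset (dA dB : Fin K → ℕ) {k l : Fin K} (h : k < l) :
    offset dA dB k + dA k * dB k ≤ offset dA dB l := by
  have hk : k ∉ Finset.Iio k := by simp
  have hsub : insert k (Finset.Iio k) ⊆ Finset.Iio l := by
    intro x hx
    rcases Finset.mem_insert.mp hx with rfl | hx
    · exact Finset.mem_Iio.mpr h
    · exact Finset.mem_Iio.mpr ((Finset.mem_Iio.mp hx).trans h)
  have hle := Finset.sum_le_sum_of_subset (f := fun i => dA i * dB i) hsub
  rw [Finset.sum_insert hk] at hle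
  unfold offset
  omega

theorem idx_lt_offset_add (dA dB : Fin K → ℕ) (k : Fin K) (b : Fin (dB k)) (a : Fin (dA k)) :
    (idx dA dB k b a : ℕ) < offset dA dB k + dA k * dB k := by
  have ha := a.isLt
  have hb : ((b : ℕ) + 1) * dA k ≤ dB k * dA k := Nat.mul_le_mul_right _ b.isLt
  rw [Nat.add_mul, Nat.one_mul, Nat.mul_comm (dB k)] at hb
  change offset dA dB k + (b : ℕ) * dA k + (a : ℕ) < _
  omega

theorem idx_lt_idx_of_lt (dA dB : Fin K → ℕ) {k l : Fin K} (h : k < l) (b : Fin (dB k))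
    (a : Fin (dA k)) (b' : Fin (dB l)) (a' : Fin (dA l)) :
    (idx dA dB k b a : ℕ) < idx dA dB l b' a' :=
  calc (idx dA dB k b a : ℕ) < offset dA dB k + dA k * dB k := idx_lt_offset_add dA dB k b a
    _ ≤ offset dA dB l := offset_add_le_offset dA dB h
    _ ≤ offset dA dB l + (b' : ℕ) * dA l + (a' : ℕ) := by omega

theorem idx_injective (dA dB : Fin K → ℕ) :
    Function.Injective (fun x : Σ k : Fin K, Fin (dA k) × Fin (dB k) =>
      idx dA dB x.1 x.2.2 x.2.1) := by
  rintro ⟨k, a, b⟩ ⟨l, a', b'⟩ h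
  have hval : (idx dA dB k b a : ℕ) = idx dA dB l b' a' := congrArg Fin.val h
  rcases lt_trichotomy k l with hkl | rfl | hkl
  · exact absurd hval (idx_lt_idx_of_lt dA dB hkl b a b' a').ne
  · have hsum : (a : ℕ) + dA k * b = a' + dA k * b' := by
      change offset dA dB k + (b : ℕ) * dA k + (a : ℕ) =
        offset dA dB k + (b' : ℕ) * dA k + (a' : ℕ) at hval
      rw [Nat.mul_comm (dA k), Nat.mul_comm (dA k)]
      omega
    have hpos : 0 < dA k := Nat.zero_lt_of_lt a.isLt
    have hmod := congrArg (· % dA k) hsum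
    have hdiv := congrArg (· / dA k) hsum
    simp only [Nat.add_mul_mod_self_left, Nat.mod_eq_of_lt a.isLt, Nat.mod_eq_of_lt a'.isLt]
      at hmod
    simp only [Nat.add_mul_div_left _ _ hpos, Nat.div_eq_of_lt a.isLt,
      Nat.div_eq_of_lt a'.isLt, Nat.zero_add] at hdiv
    rw [Fin.ext hmod, Fin.ext hdiv]
  · exact absurd hval (idx_lt_idx_of_lt dA dB hkl b' a' b a).ne'

theorem ptraceA_diagonal (dA dB : Fin K → ℕ)
    (d : (Σ k : Fin K, Fin (dA k) × Fin (dB k)) → ℂ) :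
    ptraceA dA dB (Matrix.diagonal d) =
      Matrix.diagonal (fun x : Σ k : Fin K, Fin (dB k) => ∑ a, d ⟨x.1, (a, x.2)⟩) := by
  ext ⟨k, b⟩ ⟨l, b'⟩
  by_cases hkl : l = k
  · subst hkl
    by_cases hb : b = b'
    · subst hb
      simp [ptraceA]
    · simp [ptraceA, hb]
  · have hne : (⟨k, b⟩ : Σ k : Fin K, Fin (dB k)) ≠ ⟨l, b'⟩ := fun h =>
      hkl (congrArg Sigma.fst h).symm
    simp [ptraceA, hkl, Matrix.diagonal_apply_ne _ hne]

/-- **Particle-number corollary to Theorem 1.** With `w k` the boson number of the `B`-block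
of sector `k` and `N̂_B` the corresponding diagonal particle-number operator on `ιB`, some
unitary `U` simultaneously attains the minimal entropy
`S(Tr_A (U ρ U*)) = ∑_{k,b} (- q k b * log (q k b))` and has particle-number expectation
`tr (N̂_B * Tr_A (U ρ U*)) = ∑_k w k * ∑_b q k b`. -/
theorem particle_number_corollary
    (dA dB : Fin K → ℕ) (hA : ∀ k, 1 ≤ dA k) (hB : ∀ k, 1 ≤ dB k) (hAnti : Antitone dA)
    (ρ : Matrix (Σ k : Fin K, Fin (dA k) × Fin (dB k)) (Σ k : Fin K, Fin (dA k) × Fin (dB k)) ℂ)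
    (hρ : ρ.IsHermitian) (hpos : ρ.PosSemidef) (htr : Matrix.trace ρ = 1)
    (p : Fin (∑ k', dA k' * dB k') → ℝ) (hp : Antitone p)
    (e : Fin (∑ k', dA k' * dB k') ≃ (Σ k : Fin K, Fin (dA k) × Fin (dB k)))
    (hpe : ∀ i, p i = hρ.eigenvalues (e i))
    (w : Fin K → ℕ) :
    ∃ U : Matrix.unitaryGroup (Σ k : Fin K, Fin (dA k) × Fin (dB k)) ℂ,
      vnEntropy (ptraceA dA dB ((U : Matrix _ _ ℂ) * ρ * (U : Matrix _ _ ℂ)ᴴ)) =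
        (∑ k : Fin K, ∑ b : Fin (dB k),
          (- qval dA dB p k b * Real.log (qval dA dB p k b))) ∧
      Matrix.trace
          (Matrix.diagonal (fun kb : Σ k : Fin K, Fin (dB k) => (w kb.1 : ℂ)) *
            ptraceA dA dB ((U : Matrix _ _ ℂ) * ρ * (U : Matrix _ _ ℂ)ᴴ)) =
        ((∑ k : Fin K, (w k : ℝ) * ∑ b : Fin (dB k), qval dA dB p k b : ℝ) : ℂ) := by
  let τ : (Σ k : Fin K, Fin (dA k) × Fin (dB k)) → (Σ k : Fin K, Fin (dA k) × Fin (dB k)) :=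
    fun x => e (idx dA dB x.1 x.2.2 x.2.1)
  have hτ : Function.Bijective τ :=
    Finite.injective_iff_bijective.mp (e.injective.comp (idx_injective dA dB))
  obtain ⟨U, hU⟩ := exists_unitary_conj_eq_diagonal hρ (Equiv.ofBijective τ hτ)
  have hpt : ptraceA dA dB ((U : Matrix _ _ ℂ) * ρ * (U : Matrix _ _ ℂ)ᴴ) =
      Matrix.diagonal (fun x : Σ k : Fin K, Fin (dB k) => (qval dA dB p x.1 x.2 : ℂ)) := by
    rw [hU, ptraceA_diagonal]
    congr 1
    funext x
    simp [qval, hpe, τ]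
  refine ⟨U, ?_, ?_⟩
  · rw [hpt, vnEntropy_diagonal, Fintype.sum_sigma]
  · rw [hpt, Matrix.diagonal_mul_diagonal, Matrix.trace_diagonal, Fintype.sum_sigma]
    simp [Finset.mul_sum]

end AQD
end
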